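/- Let V be a Banach space, p ≥ 1, ω̄ a strictly positive control on Δ_T, and L_0 > 0. Let g : [0,T] → V be a continuous function with finite localized p-variation with respect to (ω̄, L_0). Then for every q > p and every (s,t) ∈ Δ_T, one has lim_{L → 0^+} ‖g‖_{q,(ω̄,L),[s,t]} = 0. -/

import Mathlib

open Set

/-- The simplex `Δ_T = {(s,t) : 0 ≤ s ≤ t ≤ T}`. -/
def Simplex (T : ℝ) : Set (ℝ × ℝ) := {q | 0 ≤ q.1 ∧ q.1 ≤ q.2 ∧ q.2 ≤ T}

/-- A control on `Δ_T`: a continuous nonnegative function vanishing on the diagonal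
and superadditive. -/
structure IsControl (T : ℝ) (ω : ℝ → ℝ → ℝ) : Prop where
  nonneg : ∀ ⦃s t : ℝ⦄, 0 ≤ s → s ≤ t → t ≤ T → 0 ≤ ω s t
  cont : ContinuousOn (fun q : ℝ × ℝ => ω q.1 q.2) (Simplex T)
  diag : ∀ ⦃s : ℝ⦄, 0 ≤ s → s ≤ T → ω s s = 0
  superadd : ∀ ⦃s u t : ℝ⦄, 0 ≤ s → s ≤ u → u ≤ t → t ≤ T → ω s u + ω u t ≤ ω s t

/-- A control is strictly positive if it vanishes only on the diagonal. -/
def StrictlyPositive (T : ℝ) (ω : ℝ → ℝ → ℝ) : Prop :=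
  ∀ ⦃s t : ℝ⦄, 0 ≤ s → s ≤ t → t ≤ T → ω s t = 0 → s = t

/-- `τ 0 = s < τ 1 < ⋯ < τ N = t` is a partition of `[s,t]`. -/
def IsPartition (s t : ℝ) (N : ℕ) (τ : ℕ → ℝ) : Prop :=
  τ 0 = s ∧ τ N = t ∧ ∀ i < N, τ i < τ (i + 1)

/-- A partition is `(ω̄,L)`-admissible if `ω̄(τ i, τ (i+1)) ≤ L` for every step. -/
def IsAdmissible (ωb : ℝ → ℝ → ℝ) (L : ℝ) (N : ℕ) (τ : ℕ → ℝ) : Prop :=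
  ∀ i < N, ωb (τ i) (τ (i + 1)) ≤ L

/-- The `p`-sum of the two-index function `g` along a partition. -/
noncomputable def pSum {V : Type*} [NormedAddCommGroup V]
    (g : ℝ → ℝ → V) (p : ℝ) (N : ℕ) (τ : ℕ → ℝ) : ℝ :=
  ∑ i ∈ Finset.range N, ‖g (τ i) (τ (i + 1))‖ ^ p

/-- Increments of a one-index function, viewed as a two-index function. -/
def inc {V : Type*} [NormedAddCommGroup V] (f : ℝ → V) : ℝ → ℝ → V :=
  fun a b => f b - f a

/-- The set of `p`-sums of `g` along `(ω̄,L)`-admissible partitions of `[s,t]`. -/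
def locVarSet {V : Type*} [NormedAddCommGroup V] (g : ℝ → ℝ → V) (p : ℝ)
    (ωb : ℝ → ℝ → ℝ) (L s t : ℝ) : Set ℝ :=
  {x | ∃ N τ, IsPartition s t N τ ∧ IsAdmissible ωb L N τ ∧ x = pSum g p N τ}

/-- The localized `p`-variation `‖g‖_{p,(ω̄,L),[s,t]}^p` (raised to the `p`-th power). -/
noncomputable def locVar {V : Type*} [NormedAddCommGroup V] (g : ℝ → ℝ → V) (p : ℝ)
    (ωb : ℝ → ℝ → ℝ) (L s t : ℝ) : ℝ :=
  sSup (locVarSet g p ωb L s t)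

/-- The set of `p`-sums of `g` along arbitrary partitions of `[s,t]`. -/
def varSet {V : Type*} [NormedAddCommGroup V] (g : ℝ → ℝ → V) (p : ℝ) (s t : ℝ) : Set ℝ :=
  {x | ∃ N τ, IsPartition s t N τ ∧ x = pSum g p N τ}

/-- The (unlocalized) `p`-variation `‖g‖_{p,[s,t]}^p` (raised to the `p`-th power). -/
noncomputable def pVar {V : Type*} [NormedAddCommGroup V] (g : ℝ → ℝ → V) (p : ℝ)
    (s t : ℝ) : ℝ :=
  sSup (varSet g p s t)

theorem IsPartition.le_of_le {s t : ℝ} {N : ℕ} {τ : ℕ → ℝ} (h : IsPartition s t N τ)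
    {i j : ℕ} (hij : i ≤ j) (hj : j ≤ N) : τ i ≤ τ j := by
  induction j, hij using Nat.le_induction with
  | base => exact le_rfl
  | succ k _ ih => exact (ih (by omega)).trans (h.2.2 k (by omega)).le

theorem IsPartition.mem_Icc {s t : ℝ} {N : ℕ} {τ : ℕ → ℝ} (h : IsPartition s t N τ)
    {i : ℕ} (hi : i ≤ N) : τ i ∈ Icc s t := by
  have h0 := h.le_of_le (Nat.zero_le i) hi
  have h1 := h.le_of_le hi le_rfl
  rw [h.1] at h0
  rw [h.2.1] at h1
  exact ⟨h0, h1⟩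

theorem pSum_nonneg {V : Type*} [NormedAddCommGroup V] (g : ℝ → ℝ → V) (p : ℝ) (N : ℕ)
    (τ : ℕ → ℝ) : 0 ≤ pSum g p N τ :=
  Finset.sum_nonneg fun _ _ => Real.rpow_nonneg (norm_nonneg _) _

/-- Localized variation sums are additive under concatenation of partitions. -/
theorem add_mem_locVarSet {V : Type*} [NormedAddCommGroup V] {g : ℝ → ℝ → V} {p : ℝ}
    {ω : ℝ → ℝ → ℝ} {L a b c x y : ℝ} (hx : x ∈ locVarSet g p ω L a b)
    (hy : y ∈ locVarSet g p ω L b c) : x + y ∈ locVarSet g p ω L a c := by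
  obtain ⟨N, τ, hτ, hτL, rfl⟩ := hx
  obtain ⟨M, σ, hσ, hσL, rfl⟩ := hy
  let ρ : ℕ → ℝ := fun i => if i ≤ N then τ i else σ (i - N)
  have hleft : ∀ i ≤ N, ρ i = τ i := fun i hi => if_pos hi
  have hright : ∀ i, ρ (N + i) = σ i := by
    intro i
    rcases Nat.eq_zero_or_pos i with rfl | hi
    · rw [add_zero, hleft N le_rfl, hτ.2.1, hσ.1]
    · simp [ρ, Nat.not_le.2 (Nat.lt_add_of_pos_right hi)]
  have hsplit : ∀ P : ℝ → ℝ → Prop, (∀ i < N, P (τ i) (τ (i + 1))) →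
      (∀ i < M, P (σ i) (σ (i + 1))) → ∀ i < N + M, P (ρ i) (ρ (i + 1)) := by
    intro P h₁ h₂ i hi
    rcases lt_or_ge i N with h | h
    · rw [hleft i h.le, hleft (i + 1) h]
      exact h₁ i h
    · obtain ⟨k, rfl⟩ := Nat.exists_eq_add_of_le h
      rw [add_assoc, hright, hright]
      exact h₂ k (by omega)
  refine ⟨N + M, ρ, ⟨(hleft 0 (Nat.zero_le N)).trans hτ.1, (hright M).trans hσ.2.1,
    hsplit (· < ·) hτ.2.2 hσ.2.2⟩, hsplit (fun u v => ω u v ≤ L) hτL hσL, ?_⟩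
  unfold pSum
  rw [Finset.sum_range_add]
  congr 1
  · refine Finset.sum_congr rfl fun i hi => ?_
    have hi := Finset.mem_range.1 hi
    rw [hleft i hi.le, hleft (i + 1) hi]
  · refine Finset.sum_congr rfl fun i _ => ?_
    rw [add_assoc, hright, hright]

theorem isCompact_simplex (T : ℝ) : IsCompact (Simplex T) := by
  refine (isCompact_Icc (a := ((0 : ℝ), (0 : ℝ))) (b := (T, T))).of_isClosed_subset ?_ ?_
  · exact (isClosed_le continuous_const continuous_fst).inter
      ((isClosed_le continuous_fst continuous_snd).inter
        (isClosed_le continuous_snd continuous_const))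
  · rintro ⟨x, y⟩ ⟨h0, h1, h2⟩
    exact ⟨⟨h0, h0.trans h1⟩, ⟨h1.trans h2, h2⟩⟩

/-- A control is small on all short intervals, so admissible partitions exist. -/
theorem IsControl.locVarSet_nonempty {V : Type*} [NormedAddCommGroup V] {T : ℝ}
    {ω : ℝ → ℝ → ℝ} (hω : IsControl T ω) {L : ℝ} (hL : 0 < L) (g : ℝ → ℝ → V) (p : ℝ)
    {a b : ℝ} (ha : 0 ≤ a) (hab : a ≤ b) (hb : b ≤ T) :
    (locVarSet g p ω L a b).Nonempty := by
  rcases hab.eq_or_lt with rfl | hlt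
  · exact ⟨_, 0, fun _ => a, ⟨rfl, rfl, fun i hi => absurd hi (Nat.not_lt_zero i)⟩,
      fun i hi => absurd hi (Nat.not_lt_zero i), rfl⟩
  obtain ⟨δ, hδ, hu⟩ := Metric.uniformContinuousOn_iff.1
    ((isCompact_simplex T).uniformContinuousOn_of_continuous hω.cont) L hL
  obtain ⟨n, hn⟩ := exists_nat_gt ((b - a) / δ)
  have hn0 : (0 : ℝ) < n := (div_pos (sub_pos.2 hlt) hδ).trans hn
  set h := (b - a) / n with hh
  have hpos : 0 < h := div_pos (sub_pos.2 hlt) hn0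
  have hnh : n * h = b - a := by rw [hh]; field_simp
  have hhδ : h < δ := by
    rw [div_lt_iff₀ hδ] at hn
    rw [hh, div_lt_iff₀ hn0]
    linarith
  have hτ : IsPartition a b n (fun i => a + i * h) :=
    ⟨by simp, by simp only [hnh]; ring, fun i _ => by push_cast; linarith⟩
  refine ⟨_, n, _, hτ, fun i hi => ?_, rfl⟩
  have h1 := hτ.mem_Icc hi.le
  have h2 := hτ.mem_Icc hi
  have h3 := hτ.2.2 i hi
  set u := a + i * h
  have hv : a + ((i + 1 : ℕ) : ℝ) * h = u + h := by push_cast; simp only [u]; ring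
  simp only [hv] at h2 h3 ⊢
  have hd : dist (u, u + h) (u, u) < δ := by
    simpa [Prod.dist_eq, abs_of_pos hpos] using ⟨hδ, hhδ⟩
  have hu0 : 0 ≤ u := ha.trans h1.1
  have huT : u ≤ T := h1.2.trans hb
  have := hu (u, u + h) ⟨hu0, h3.le, h2.2.trans hb⟩ (u, u) ⟨hu0, le_rfl, huT⟩ hd
  simp only [hω.diag hu0 huT, Real.dist_eq, sub_zero] at this
  exact (le_abs_self _).trans this.le

/-- Bounded localized variation sums on `[0,T]` give the same bound on subintervals and
for smaller localization thresholds. -/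
theorem IsControl.pSum_le_of_mem_upperBounds {V : Type*} [NormedAddCommGroup V] {T : ℝ}
    {ω : ℝ → ℝ → ℝ} (hω : IsControl T ω) {L₀ : ℝ} (hL₀ : 0 < L₀) {g : ℝ → ℝ → V} {p C : ℝ}
    (hC : C ∈ upperBounds (locVarSet g p ω L₀ 0 T)) {s t : ℝ} (hst : (s, t) ∈ Simplex T)
    {L : ℝ} (hL : L ≤ L₀) {N : ℕ} {τ : ℕ → ℝ} (hτ : IsPartition s t N τ)
    (hτL : IsAdmissible ω L N τ) : pSum g p N τ ≤ C := by
  obtain ⟨h0, h1, h2⟩ := hst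
  obtain ⟨x, hx⟩ := hω.locVarSet_nonempty hL₀ g p le_rfl h0 (h1.trans h2)
  obtain ⟨y, hy⟩ := hω.locVarSet_nonempty hL₀ g p (h0.trans h1) h2 le_rfl
  have hmem : pSum g p N τ ∈ locVarSet g p ω L₀ s t :=
    ⟨N, τ, hτ, fun i hi => (hτL i hi).trans hL, rfl⟩
  have hle := hC (add_mem_locVarSet (add_mem_locVarSet hx hmem) hy)
  have hx0 : 0 ≤ x := by
    obtain ⟨_, _, _, _, rfl⟩ := hx
    exact pSum_nonneg _ _ _ _
  have hy0 : 0 ≤ y := by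
    obtain ⟨_, _, _, _, rfl⟩ := hy
    exact pSum_nonneg _ _ _ _
  linarith

/-- The increments of a continuous path are small wherever a strictly positive control is. -/
theorem IsControl.exists_norm_inc_le {V : Type*} [NormedAddCommGroup V] {T : ℝ}
    {ω : ℝ → ℝ → ℝ} (hω : IsControl T ω) (hpos : StrictlyPositive T ω) {g : ℝ → V}
    (hg : ContinuousOn g (Icc 0 T)) {ε : ℝ} (hε : 0 < ε) :
    ∃ L > 0, ∀ z ∈ Simplex T, ω z.1 z.2 < L → ‖inc g z.1 z.2‖ ≤ ε := by
  have hcont : ContinuousOn (fun z : ℝ × ℝ => ‖inc g z.1 z.2‖) (Simplex T) :=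
    ((hg.comp continuousOn_snd fun z hz => ⟨hz.1.trans hz.2.1, hz.2.2⟩).sub
      (hg.comp continuousOn_fst fun z hz => ⟨hz.1, hz.2.1.trans hz.2.2⟩)).norm
  let K := Simplex T ∩ (fun z : ℝ × ℝ => ‖inc g z.1 z.2‖) ⁻¹' Ici ε
  have hK : IsCompact K := (isCompact_simplex T).of_isClosed_subset
    (hcont.preimage_isClosed_of_isClosed (isCompact_simplex T).isClosed isClosed_Ici)
    inter_subset_left
  rcases K.eq_empty_or_nonempty with hempty | hne
  · refine ⟨1, one_pos, fun z hz _ => ?_⟩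
    by_contra! hlt
    exact eq_empty_iff_forall_notMem.1 hempty z ⟨hz, hlt.le⟩
  · obtain ⟨m, hm, hmin⟩ := hK.exists_isMinOn hne (hω.cont.mono inter_subset_left)
    have hm0 : ω m.1 m.2 ≠ 0 := fun h => by
      have heq := hpos hm.1.1 hm.1.2.1 hm.1.2.2 h
      have : ε ≤ ‖inc g m.1 m.2‖ := hm.2
      rw [heq, inc, sub_self, norm_zero] at this
      linarith
    refine ⟨ω m.1 m.2, lt_of_le_of_ne (hω.nonneg hm.1.1 hm.1.2.1 hm.1.2.2) hm0.symm,
      fun z hz hlt => ?_⟩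
    by_contra! hgt
    exact absurd (hmin (show z ∈ K from ⟨hz, hgt.le⟩)) (not_le.2 hlt)

/-- Interpolation: if all increments are at most `ε`, the `q`-sum is controlled by the
`p`-sum. -/
theorem pSum_le_rpow_mul_pSum {V : Type*} [NormedAddCommGroup V] {g : ℝ → ℝ → V} {p q ε : ℝ}
    (hp : 0 < p) (hpq : p ≤ q) {N : ℕ} {τ : ℕ → ℝ}
    (h : ∀ i < N, ‖g (τ i) (τ (i + 1))‖ ≤ ε) :
    pSum g q N τ ≤ ε ^ (q - p) * pSum g p N τ := by
  unfold pSum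
  rw [Finset.mul_sum]
  refine Finset.sum_le_sum fun i hi => ?_
  calc ‖g (τ i) (τ (i + 1))‖ ^ q
      = ‖g (τ i) (τ (i + 1))‖ ^ (q - p) * ‖g (τ i) (τ (i + 1))‖ ^ p := by
        rw [← Real.rpow_add_of_nonneg (norm_nonneg _) (sub_nonneg.2 hpq) hp.le, sub_add_cancel]
    _ ≤ ε ^ (q - p) * ‖g (τ i) (τ (i + 1))‖ ^ p :=
        mul_le_mul_of_nonneg_right (Real.rpow_le_rpow (norm_nonneg _)
          (h i (Finset.mem_range.1 hi)) (sub_nonneg.2 hpq)) (Real.rpow_nonneg (norm_nonneg _) _)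

theorem locVar_nonneg {V : Type*} [NormedAddCommGroup V] (g : ℝ → ℝ → V) (p : ℝ)
    (ω : ℝ → ℝ → ℝ) (L s t : ℝ) : 0 ≤ locVar g p ω L s t := by
  refine Real.sSup_nonneg ?_
  rintro _ ⟨N, τ, _, _, rfl⟩
  exact pSum_nonneg _ _ _ _

/-- If `ω̄` is a strictly positive control and `g` is a continuous path of
finite localized `p`-variation with respect to `(ω̄, L₀)`, then for every `q > p` and every
`(s,t) ∈ Δ_T`, the localized `q`-variation `‖g‖_{q,(ω̄,L),[s,t]}` tends to `0` as `L → 0⁺`. -/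
theorem statement4 {V : Type*} [NormedAddCommGroup V] [NormedSpace ℝ V] [CompleteSpace V]
    (T : ℝ) (hT : 0 < T) (p q : ℝ) (hp : 1 ≤ p) (hpq : p < q)
    (ωb : ℝ → ℝ → ℝ) (hωb : IsControl T ωb) (hpos : StrictlyPositive T ωb)
    (L₀ : ℝ) (hL₀ : 0 < L₀)
    (g : ℝ → V) (hgc : ContinuousOn g (Icc 0 T))
    (hgfin : BddAbove (locVarSet (inc g) p ωb L₀ 0 T))
    (s t : ℝ) (hst : (s, t) ∈ Simplex T) :
    Filter.Tendsto (fun L : ℝ => locVar (inc g) q ωb L s t ^ (1 / q))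
      (nhdsWithin 0 (Set.Ioi 0)) (nhds 0) := by
  obtain ⟨C, hC⟩ := hgfin
  have hp0 : 0 < p := one_pos.trans_le hp
  have hC0 : 0 ≤ C := by
    obtain ⟨x, hx⟩ := hωb.locVarSet_nonempty hL₀ (inc g) p le_rfl hT.le le_rfl
    have hxC := hC hx
    obtain ⟨_, _, _, _, rfl⟩ := hx
    exact (pSum_nonneg _ _ _ _).trans hxC
  have hsmall : Filter.Tendsto (fun ε : ℝ => ε ^ (q - p) * C)
      (nhdsWithin 0 (Set.Ioi 0)) (nhds 0) := by
    have h := ((Real.continuousAt_rpow_const 0 (q - p) (Or.inr (sub_pos.2 hpq).le)).mul_const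
      C).tendsto
    rw [Real.zero_rpow (sub_pos.2 hpq).ne', zero_mul] at h
    exact h.mono_left nhdsWithin_le_nhds
  have hlim : Filter.Tendsto (fun L : ℝ => locVar (inc g) q ωb L s t)
      (nhdsWithin 0 (Set.Ioi 0)) (nhds 0) := by
    refine tendsto_order.2 ⟨fun a ha => Filter.Eventually.of_forall fun L =>
      ha.trans_le (locVar_nonneg _ _ _ _ _ _), fun η hη => ?_⟩
    obtain ⟨ε, hεη, hε⟩ := ((hsmall.eventually_lt_const hη).and self_mem_nhdsWithin).exists
    obtain ⟨L₁, hL₁, hinc⟩ := hωb.exists_norm_inc_le hpos hgc hε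
    filter_upwards [nhdsWithin_le_nhds (Iio_mem_nhds (lt_min hL₀ hL₁))] with L hL
    obtain ⟨hLL₀, hLL₁⟩ := lt_min_iff.1 (mem_Iio.1 hL)
    have hε0 : 0 ≤ ε ^ (q - p) := Real.rpow_nonneg (le_of_lt hε) _
    refine (Real.sSup_le ?_ (mul_nonneg hε0 hC0)).trans_lt hεη
    rintro _ ⟨N, τ, hτ, hτL, rfl⟩
    refine (pSum_le_rpow_mul_pSum hp0 hpq.le fun i hi => ?_).trans
      (mul_le_mul_of_nonneg_left (hωb.pSum_le_of_mem_upperBounds hL₀ hC hst hLL₀.le hτ hτL) hε0)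
    exact hinc (τ i, τ (i + 1)) ⟨hst.1.trans (hτ.mem_Icc hi.le).1, (hτ.2.2 i hi).le,
      (hτ.mem_Icc hi).2.trans hst.2.2⟩ ((hτL i hi).trans_lt hLL₁)
  have hq : 0 < 1 / q := one_div_pos.2 (hp0.trans hpq)
  have hroot := hlim.rpow_const (p := 1 / q) (Or.inr hq.le)
  rwa [Real.zero_rpow hq.ne'] at hroot
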